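/- arXiv:1201.2926 — 6 statements merged into one kernel-verified Lean document; each statement's English description precedes it below -/
import Mathlib

section
/- Let G be a group equipped with an invariant norm ‖·‖ acting on a set M, and let N ⊆ M be a subset. If g ∈ G satisfies δ(N, g•N) = 0, then the rigid locus satisfies R_N ⊆ N ∩ (g•N). -/
open scoped Pointwise

/-- The norm-closure `Σ̄_N` of the stabilizer of `N ⊆ M`. -/
def sigmaBar {G M : Type*} [Group G] [MulAction G M] (ν : G → ℝ) (N : Set M) : Set G :=
  {g : G | ∀ ε : ℝ, 0 < ε → ∃ h : G, h • N = N ∧ ν (g * h⁻¹) < ε}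

/-- The rigid locus `R_N = {x ∈ N : ∀ φ ∈ Σ̄_N, φ • x ∈ N}`. -/
def rigidLocus {G M : Type*} [Group G] [MulAction G M] (ν : G → ℝ) (N : Set M) : Set M :=
  {x ∈ N | ∀ φ ∈ sigmaBar (G := G) ν N, φ • x ∈ N}

/-- if `δ(N, g • N) = 0` (i.e. for every `ε > 0` there is `h` with
`h • N = g • N` and `ν h < ε`), then `R_N ⊆ N ∩ (g • N)`. -/
theorem stmt5 {G M : Type*} [Group G] [MulAction G M] (ν : G → ℝ)
    (hnn : ∀ g : G, 0 ≤ ν g)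
    (hzero : ∀ g : G, ν g = 0 ↔ g = 1)
    (hinv : ∀ g : G, ν g⁻¹ = ν g)
    (htri : ∀ g h : G, ν (g * h) ≤ ν g + ν h)
    (hconj : ∀ g h : G, ν (h⁻¹ * g * h) = ν g)
    (N : Set M) (g : G)
    (hg : ∀ ε : ℝ, 0 < ε → ∃ h : G, h • N = g • N ∧ ν h < ε) :
    rigidLocus (G := G) ν N ⊆ N ∩ (g • N) := by
  rintro x ⟨hxN, hx⟩
  refine ⟨hxN, Set.mem_smul_set_iff_inv_smul_mem.2 (hx g⁻¹ fun ε hε => ?_)⟩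
  obtain ⟨h, hh, hlt⟩ := hg ε hε
  refine ⟨g⁻¹ * h, by rw [mul_smul, hh, inv_smul_smul], ?_⟩
  rwa [mul_inv_rev, inv_inv, ← mul_assoc, hconj, hinv]
end

section
/- Let s ≥ 2 be an integer and let A_k ∈ Sym^k(V,W) for 1 ≤ k ≤ s. Then the (s+1)-linear form τ_{A₁,…,A_s} belongs to T_s(V); that is, for all v₀, …, v_s ∈ V: (i) τ_{A₁,…,A_s}(v₀,v₁,…,v_{s−1},v_s) = −τ_{A₁,…,A_s}(v_s,v₁,…,v_{s−1},v₀); (ii) τ_{A₁,…,A_s}(v₀,v_{σ(1)},…,v_{σ(s−1)},v_s) = τ_{A₁,…,A_s}(v₀,v₁,…,v_{s−1},v_s) for every permutation σ of {1,…,s−1}; and (iii) τ_{A₁,…,A_s}(v₀,v₁,v₂,…,v_{s−1},v_s) + τ_{A₁,…,A_s}(v_s,v₀,v₂,…,v_{s−1},v₁) + τ_{A₁,…,A_s}(v₁,v_s,v₂,…,v_{s−1},v₀) = 0. -/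
/-- The index in `Fin (s+1)` corresponding to the `t`-th "middle" argument
(`t : Fin (s-1)` corresponds to the argument `v_{t+1}`). -/
def midIdx {s : ℕ} (t : Fin (s - 1)) : Fin (s + 1) :=
  ⟨t.val + 1, Nat.succ_lt_succ (lt_of_lt_of_le t.isLt (Nat.sub_le s 1))⟩

/-- The `(s+1)`-linear form `τ_{A₁,…,A_s}` of the paper, defined by
`τ(v₀,…,v_s) = ∑_{T ⊆ {1,…,s-1}} ω(A_{|T|+1}(v₀, v_T), A_{s-|T|}(v_{Tᶜ}, v_s))`,
where the elements of `T` and of its complement are listed in increasing order. -/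
noncomputable def tauForm {V W : Type*} [AddCommGroup V] [Module ℝ V]
    [AddCommGroup W] [Module ℝ W]
    (ω : W →ₗ[ℝ] W →ₗ[ℝ] ℝ) (s : ℕ)
    (A : (k : ℕ) → MultilinearMap ℝ (fun _ : Fin k => V) W)
    (v : Fin (s + 1) → V) : ℝ :=
  ∑ T : Finset (Fin (s - 1)),
    ω (A (T.card + 1) (Fin.cons (v 0)
        (fun i => v (midIdx ((T.orderIsoOfFin rfl i : Fin (s - 1)))))))
      (A (s - T.card) (fun i =>
        if h : (i : ℕ) < Tᶜ.card then
          v (midIdx ((Tᶜ.orderIsoOfFin rfl ⟨(i : ℕ), h⟩ : Fin (s - 1))))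
        else v (Fin.last s)))

/-- The value of the family `A` on the subfamily of `v` indexed by `S`, listed in increasing
order. -/
noncomputable def evalOn {V W ι : Type*} [AddCommGroup V] [Module ℝ V]
    [AddCommGroup W] [Module ℝ W] [LinearOrder ι]
    (A : (k : ℕ) → MultilinearMap ℝ (fun _ : Fin k => V) W) (v : ι → V) (S : Finset ι) : W :=
  A S.card (fun i => v (S.orderIsoOfFin rfl i))

/-- A symmetric multilinear map may be evaluated along any enumeration of an index set. -/
theorem apply_eq_evalOn {V W ι : Type*} [AddCommGroup V] [Module ℝ V]
    [AddCommGroup W] [Module ℝ W] [LinearOrder ι]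
    (A : (k : ℕ) → MultilinearMap ℝ (fun _ : Fin k => V) W) {k : ℕ}
    (hA : ∀ (σ : Equiv.Perm (Fin k)) (m : Fin k → V), A k (fun i => m (σ i)) = A k m)
    (v : ι → V) (S : Finset ι) (hk : S.card = k) (e : Fin k → ι)
    (he : Function.Injective e) (heS : ∀ i, e i ∈ S) :
    A k (fun i => v (e i)) = evalOn A v S := by
  subst hk
  let g : Fin S.card → Fin S.card := fun i => (S.orderIsoOfFin rfl).symm ⟨e i, heS i⟩
  have hg : Function.Injective g := fun i j hij =>
    he (congrArg Subtype.val ((S.orderIsoOfFin rfl).symm.injective hij))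
  have h := hA (Equiv.ofBijective g (Finite.injective_iff_bijective.mp hg))
    (fun i => v (S.orderIsoOfFin rfl i))
  simpa [g, evalOn] using h

theorem evalOn_comp_perm {V W ι : Type*} [AddCommGroup V] [Module ℝ V]
    [AddCommGroup W] [Module ℝ W] [LinearOrder ι]
    (A : (k : ℕ) → MultilinearMap ℝ (fun _ : Fin k => V) W)
    (v : ι → V) (σ : Equiv.Perm ι) (S : Finset ι)
    (hA : ∀ (τ : Equiv.Perm (Fin S.card)) (m : Fin S.card → V),
      A S.card (fun i => m (τ i)) = A S.card m) :
    evalOn A (fun i => v (σ i)) S = evalOn A v (S.map σ.toEmbedding) :=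
  apply_eq_evalOn A hA v (S.map σ.toEmbedding) (Finset.card_map _)
    (fun i => σ (S.orderIsoOfFin rfl i))
    (fun i j hij => by simpa using hij) (fun i => by simp)

/-- The sum of `f` over the sets containing `a` but not `b`. -/
def sepSum {ι : Type*} [Fintype ι] [DecidableEq ι] (f : Finset ι → ℝ) (a b : ι) : ℝ :=
  ∑ S : Finset ι with a ∈ S ∧ b ∉ S, f S

theorem sepSum_swap {ι : Type*} [Fintype ι] [DecidableEq ι] {f : Finset ι → ℝ}
    (hf : ∀ S, f Sᶜ = -f S) (a b : ι) : sepSum f b a = -sepSum f a b := by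
  unfold sepSum
  rw [← Finset.sum_neg_distrib]
  refine Finset.sum_nbij' compl compl ?_ ?_ ?_ ?_ ?_ <;> simp +contextual [hf]

theorem sepSum_sub_sepSum_swap {ι : Type*} [Fintype ι] [DecidableEq ι] (f : Finset ι → ℝ)
    (a b : ι) : sepSum f a b - sepSum f b a =
      (∑ S : Finset ι with a ∈ S, f S) - ∑ S : Finset ι with b ∈ S, f S := by
  simp only [sepSum, Finset.sum_filter, ← Finset.sum_sub_distrib]
  refine Finset.sum_congr rfl fun S _ => ?_
  by_cases ha : a ∈ S <;> by_cases hb : b ∈ S <;> simp [ha, hb]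

theorem sepSum_cyclic {ι : Type*} [Fintype ι] [DecidableEq ι] {f : Finset ι → ℝ}
    (hf : ∀ S, f Sᶜ = -f S) (a b c : ι) :
    sepSum f a b + sepSum f b c + sepSum f c a = 0 := by
  linarith [sepSum_swap hf a b, sepSum_swap hf b c, sepSum_swap hf c a,
    sepSum_sub_sepSum_swap f a b, sepSum_sub_sepSum_swap f b c, sepSum_sub_sepSum_swap f c a]

theorem midIdx_injective {s : ℕ} : Function.Injective (midIdx (s := s)) := fun i j h => by
  simpa [midIdx, Fin.ext_iff] using h

theorem midIdx_ne_zero {s : ℕ} (t : Fin (s - 1)) : midIdx t ≠ 0 := by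
  simp [midIdx, Fin.ext_iff]

theorem midIdx_ne_last {s : ℕ} (t : Fin (s - 1)) : midIdx t ≠ Fin.last s := by
  have := t.isLt
  simp only [midIdx, Fin.ext_iff, Fin.val_last, ne_eq]
  omega

theorem exists_midIdx_eq {s : ℕ} {i : Fin (s + 1)} (h0 : i ≠ 0) (hl : i ≠ Fin.last s) :
    ∃ t : Fin (s - 1), midIdx t = i := by
  have := i.isLt
  simp only [ne_eq, Fin.ext_iff, Fin.val_zero, Fin.val_last] at h0 hl
  refine ⟨⟨i - 1, by omega⟩, ?_⟩
  simp only [midIdx, Fin.ext_iff]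
  omega

/-- The form `τ` as a sum over all subsets of the index set separating the first index from the
last one. -/
theorem tauForm_eq_sepSum {V W : Type*} [AddCommGroup V] [Module ℝ V]
    [AddCommGroup W] [Module ℝ W] (ω : W →ₗ[ℝ] W →ₗ[ℝ] ℝ) {s : ℕ} (hs : 1 ≤ s)
    (A : (k : ℕ) → MultilinearMap ℝ (fun _ : Fin k => V) W)
    (hA : ∀ k : ℕ, 1 ≤ k → k ≤ s → ∀ (σ : Equiv.Perm (Fin k)) (m : Fin k → V),
      A k (fun i => m (σ i)) = A k m) (v : Fin (s + 1) → V) :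
    tauForm ω s A v = sepSum (fun S => ω (evalOn A v S) (evalOn A v Sᶜ)) 0 (Fin.last s) := by
  have hlast : Fin.last s ≠ 0 := by
    simp only [ne_eq, Fin.ext_iff, Fin.val_last, Fin.val_zero]
    omega
  unfold tauForm sepSum
  refine Finset.sum_nbij' (fun T => insert 0 (T.image midIdx))
    (fun S => Finset.univ.filter fun t => midIdx t ∈ S) ?_ ?_ ?_ ?_ ?_
  · intro T _
    simp [hlast, midIdx_ne_last]
  · simp
  · intro T _
    ext t
    simp [midIdx_ne_zero, midIdx_injective.eq_iff]
  · intro S hS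
    simp only [Finset.mem_filter, Finset.mem_univ, true_and] at hS
    ext i
    simp only [Finset.mem_insert, Finset.mem_image, Finset.mem_filter, Finset.mem_univ, true_and]
    constructor
    · rintro (rfl | ⟨t, ht, rfl⟩)
      exacts [hS.1, ht]
    · intro hi
      by_cases h0 : i = 0
      · exact Or.inl h0
      · obtain ⟨t, rfl⟩ := exists_midIdx_eq h0 (fun h => hS.2 (h ▸ hi))
        exact Or.inr ⟨t, hi, rfl⟩
  · intro T _
    have hT : T.card ≤ s - 1 := by simpa using T.card_le_univ
    have hTc : Tᶜ.card = s - 1 - T.card := by simp [Finset.card_compl]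
    have hcard : (insert 0 (T.image midIdx) : Finset (Fin (s + 1))).card = T.card + 1 := by
      rw [Finset.card_insert_of_notMem (by simp [midIdx_ne_zero]),
        Finset.card_image_of_injective _ midIdx_injective]
    congr 1
    · congr 1
      rw [← apply_eq_evalOn A (hA (T.card + 1) (by omega) (by omega)) v _ hcard
        (Fin.cons 0 fun i => midIdx (T.orderIsoOfFin rfl i : Fin (s - 1)))]
      · congr 1
        ext i
        refine Fin.cases ?_ (fun j => ?_) i <;> simp
      · rw [Fin.cons_injective_iff]
        refine ⟨?_, fun i j hij => by simpa using midIdx_injective hij⟩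
        rintro ⟨i, hi⟩
        exact midIdx_ne_zero _ hi
      · intro i
        refine Fin.cases (by simp) (fun j => ?_) i
        simpa using Or.inr ⟨_, (T.orderIsoOfFin rfl j).2, rfl⟩
    · rw [← apply_eq_evalOn A (hA (s - T.card) (by omega) (by omega)) v
        (insert 0 (T.image midIdx))ᶜ
        (by rw [Finset.card_compl, hcard, Fintype.card_fin]; omega)
        (fun i => if h : (i : ℕ) < Tᶜ.card then
          midIdx (Tᶜ.orderIsoOfFin rfl ⟨(i : ℕ), h⟩ : Fin (s - 1)) else Fin.last s)]
      · congr 1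
        ext i
        split_ifs <;> rfl
      · intro i j hij
        have := i.isLt
        have := j.isLt
        dsimp only at hij
        split_ifs at hij with hi hj hj
        · simpa [Fin.ext_iff] using midIdx_injective hij
        · exact absurd hij (midIdx_ne_last _)
        · exact absurd hij.symm (midIdx_ne_last _)
        · ext
          omega
      · intro i
        split_ifs with hi
        · simpa [midIdx_ne_zero, midIdx_injective.eq_iff] using
            Finset.mem_compl.mp (Tᶜ.orderIsoOfFin rfl ⟨(i : ℕ), hi⟩).2
        · simp [hlast, midIdx_ne_last]

theorem tauForm_comp_perm {V W : Type*} [AddCommGroup V] [Module ℝ V]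
    [AddCommGroup W] [Module ℝ W] (ω : W →ₗ[ℝ] W →ₗ[ℝ] ℝ) {s : ℕ} (hs : 1 ≤ s)
    (A : (k : ℕ) → MultilinearMap ℝ (fun _ : Fin k => V) W)
    (hA : ∀ k : ℕ, 1 ≤ k → k ≤ s → ∀ (σ : Equiv.Perm (Fin k)) (m : Fin k → V),
      A k (fun i => m (σ i)) = A k m) (v : Fin (s + 1) → V) (σ : Equiv.Perm (Fin (s + 1))) :
    tauForm ω s A (fun i => v (σ i)) =
      sepSum (fun S => ω (evalOn A v S) (evalOn A v Sᶜ)) (σ 0) (σ (Fin.last s)) := by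
  rw [tauForm_eq_sepSum ω hs A hA]
  unfold sepSum
  refine Finset.sum_nbij' (fun S => S.map σ.toEmbedding)
    (fun S => S.map σ.symm.toEmbedding) ?_ ?_ ?_ ?_ ?_
  · simp
  · simp [Finset.mem_map_equiv]
  · intro S _
    ext
    simp [Finset.mem_map_equiv]
  · intro S _
    ext
    simp [Finset.mem_map_equiv]
  · intro S hS
    simp only [Finset.mem_filter, Finset.mem_univ, true_and] at hS
    have h1 : 0 < S.card := Finset.card_pos.mpr ⟨_, hS.1⟩
    have h2 : 0 < Sᶜ.card := Finset.card_pos.mpr ⟨_, Finset.mem_compl.mpr hS.2⟩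
    have h3 : S.card + Sᶜ.card = s + 1 := by simp
    have hc : (S.map σ.toEmbedding)ᶜ = Sᶜ.map σ.toEmbedding := by
      ext
      simp [Finset.mem_map_equiv]
    rw [hc, evalOn_comp_perm A v σ S (hA _ (by omega) (by omega)),
      evalOn_comp_perm A v σ Sᶜ (hA _ (by omega) (by omega))]

/-- `τ_{A₁,…,A_s}` satisfies the defining identities (i), (ii), (iii) of
the space `T_s(V)`:
(i) it is antisymmetric under exchanging the first and last arguments;
(ii) it is symmetric in the middle `s-1` arguments;
(iii) the cyclic sum over the permutations of the arguments `v₀, v₁, v_s` vanishes. -/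
theorem stmt7 {V W : Type*} [AddCommGroup V] [Module ℝ V]
    [AddCommGroup W] [Module ℝ W] [FiniteDimensional ℝ V] [FiniteDimensional ℝ W]
    (ω : W →ₗ[ℝ] W →ₗ[ℝ] ℝ)
    (hanti : ∀ w₁ w₂ : W, ω w₁ w₂ = - ω w₂ w₁)
    (hnond : ∀ w : W, (∀ w' : W, ω w w' = 0) → w = 0)
    (s : ℕ) (hs : 2 ≤ s)
    (A : (k : ℕ) → MultilinearMap ℝ (fun _ : Fin k => V) W)
    (hAsym : ∀ k : ℕ, 1 ≤ k → k ≤ s → ∀ (σ : Equiv.Perm (Fin k)) (m : Fin k → V),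
      A k (fun i => m (σ i)) = A k m) :
    (∀ v : Fin (s + 1) → V,
      tauForm ω s A (fun i => v (Equiv.swap 0 (Fin.last s) i)) = - tauForm ω s A v) ∧
    (∀ (v : Fin (s + 1) → V) (σ : Equiv.Perm (Fin (s + 1))),
      σ 0 = 0 → σ (Fin.last s) = Fin.last s →
      tauForm ω s A (fun i => v (σ i)) = tauForm ω s A v) ∧
    (∀ v : Fin (s + 1) → V,
      tauForm ω s A v
        + tauForm ω s A (fun i =>
            v ((Equiv.swap (1 : Fin (s + 1)) (Fin.last s) * Equiv.swap 0 1 : Equiv.Perm (Fin (s + 1))) i))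
        + tauForm ω s A (fun i =>
            v ((Equiv.swap (1 : Fin (s + 1)) (Fin.last s) * Equiv.swap 0 1 : Equiv.Perm (Fin (s + 1)))
              ((Equiv.swap (1 : Fin (s + 1)) (Fin.last s) * Equiv.swap 0 1 : Equiv.Perm (Fin (s + 1))) i))) = 0) := by
  have hs1 : 1 ≤ s := by omega
  have h10 : (1 : Fin (s + 1)) ≠ 0 := by
    rw [ne_eq, Fin.one_eq_zero_iff]
    omega
  have hl0 : Fin.last s ≠ 0 := by
    rw [ne_eq, Fin.last_eq_zero_iff]
    omega
  have hl1 : Fin.last s ≠ 1 := by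
    obtain ⟨n, rfl⟩ := Nat.exists_eq_add_of_le' hs
    simp [Fin.ext_iff]
  have hf (v : Fin (s + 1) → V) (S : Finset (Fin (s + 1))) :
      ω (evalOn A v Sᶜ) (evalOn A v Sᶜᶜ) = -ω (evalOn A v S) (evalOn A v Sᶜ) := by
    rw [compl_compl, hanti]
  have hτ := tauForm_comp_perm ω hs1 A hAsym
  refine ⟨fun v => ?_, fun v σ h0 hl => ?_, fun v => ?_⟩
  · rw [hτ, tauForm_eq_sepSum ω hs1 A hAsym, Equiv.swap_apply_left, Equiv.swap_apply_right]
    exact sepSum_swap (hf v) _ _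
  · rw [hτ, tauForm_eq_sepSum ω hs1 A hAsym, h0, hl]
  · set p : Equiv.Perm (Fin (s + 1)) := Equiv.swap 1 (Fin.last s) * Equiv.swap 0 1 with hp
    have hp0 : p 0 = Fin.last s := by simp [hp]
    have hp1 : p 1 = 0 := by simp [hp, Equiv.swap_apply_of_ne_of_ne h10.symm hl0.symm]
    have hpl : p (Fin.last s) = 1 := by simp [hp, Equiv.swap_apply_of_ne_of_ne hl0 hl1]
    have hpp := hτ v (p * p)
    simp only [Equiv.Perm.mul_apply, hp0, hp1, hpl] at hpp
    rw [hpp, hτ v p, hp0, hpl, tauForm_eq_sepSum ω hs1 A hAsym]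
    exact sepSum_cyclic (hf v) _ _ _
end

section
/- Let s ≥ 3 be an integer, let A_k ∈ Sym^k(V,W) for 1 ≤ k ≤ s, and let v, v₀, …, v_{s−1} ∈ V. For 2 ≤ j ≤ s let A_j(v,·) ∈ Sym^{j−1}(V,W) denote the symmetric (j−1)-linear map obtained by inserting v as the first argument of A_j. Then the (polynomial) function t ↦ τ_{A₁+tA₂(v,·), A₂+tA₃(v,·), …, A_{s−1}+tA_s(v,·)}(v₀,v₁,…,v_{s−2},v_{s−1}) has derivative at t = 0 equal to τ_{A₁,…,A_s}(v₀,…,v_{s−2},v,v_{s−1}). -/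
theorem Finset.exists_perm_comp_eq_of_map_univ_val_eq {α β : Type*} [Fintype α] {f g : α → β}
    (h : (Finset.univ : Finset α).val.map f = (Finset.univ : Finset α).val.map g) :
    ∃ σ : Equiv.Perm α, ∀ a, g (σ a) = f a := by
  classical
  have hfib (c : β) : Nonempty ({a // f a = c} ≃ {a // g a = c}) := by
    rw [← Fintype.card_eq, Fintype.card_subtype, Fintype.card_subtype]
    have hc := congrArg (Multiset.count c) h
    rw [Multiset.count_map, Multiset.count_map] at hc
    simpa only [Finset.card_def, Finset.filter_val, eq_comm (a := c)] using hc
  exact ⟨Equiv.ofFiberEquiv fun c => (hfib c).some, Equiv.ofFiberEquiv_map _⟩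

theorem MultilinearMap.eq_of_map_univ_eq {V W : Type*} [AddCommGroup V] [Module ℝ V]
    [AddCommGroup W] [Module ℝ W] {A : (k : ℕ) → MultilinearMap ℝ (fun _ : Fin k => V) W}
    {k l : ℕ} (hA : ∀ (σ : Equiv.Perm (Fin k)) (m : Fin k → V), A k (fun i => m (σ i)) = A k m)
    (hkl : k = l) {m : Fin k → V} {m' : Fin l → V}
    (h : (Finset.univ : Finset (Fin k)).val.map m = (Finset.univ : Finset (Fin l)).val.map m') :
    A k m = A l m' := by
  subst hkl
  obtain ⟨σ, hσ⟩ := Finset.exists_perm_comp_eq_of_map_univ_val_eq h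
  rw [← hA σ m']
  exact congrArg _ (funext fun i => (hσ i).symm)

theorem Fin.map_univ_val_cons {V : Type*} {n : ℕ} (x : V) (f : Fin n → V) :
    (Finset.univ : Finset (Fin (n + 1))).val.map (Fin.cons x f : Fin (n + 1) → V) =
      x ::ₘ (Finset.univ : Finset (Fin n)).val.map f := by
  simp [Fin.univ_succ, Function.comp_def]

theorem Finset.map_univ_val_orderIsoOfFin {α V : Type*} [LinearOrder α] (T : Finset α)
    (g : α → V) :
    (Finset.univ : Finset (Fin T.card)).val.map (fun i => g (T.orderIsoOfFin rfl i)) =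
      T.val.map g := by
  conv_rhs => rw [← Finset.map_orderEmbOfFin_univ T rfl]
  rw [Finset.map_val, Multiset.map_map]
  rfl

theorem Finset.map_univ_val_orderIsoOfFin_dite {α V : Type*} [LinearOrder α] (T : Finset α)
    (g : α → V) (x : V) {k : ℕ} (hk : k = T.card + 1) :
    (Finset.univ : Finset (Fin k)).val.map
      (fun i : Fin k => if h : (i : ℕ) < T.card then g (T.orderIsoOfFin rfl ⟨(i : ℕ), h⟩) else x) =
      x ::ₘ T.val.map g := by
  subst hk
  rw [← Finset.map_univ_val_orderIsoOfFin T]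
  simp [Fin.univ_castSuccEmb, Function.comp_def]

theorem Fin.sum_finset_succ {M : Type*} [AddCommMonoid M] {n : ℕ} (f : Finset (Fin (n + 1)) → M) :
    ∑ T, f T = ∑ S : Finset (Fin n), f (S.map Fin.castSuccEmb) +
      ∑ S : Finset (Fin n), f (insert (Fin.last n) (S.map Fin.castSuccEmb)) := by
  have h : (Finset.univ : Finset (Finset (Fin n))) = Finset.univ.powerset := by simp
  rw [← Finset.powerset_univ, Fin.univ_castSuccEmb, Finset.cons_eq_insert,
    Finset.sum_powerset_insert (by simp), Finset.map_eq_image, h, Finset.powerset_image]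
  rw [Finset.sum_image, Finset.sum_image]
  · simp [Finset.map_eq_image]
  all_goals
    intro a _ b _ hab
    exact Finset.image_injective (Fin.castSucc_injective n) hab

theorem Fin.compl_map_castSuccEmb {n : ℕ} (S : Finset (Fin n)) :
    (S.map Fin.castSuccEmb)ᶜ = Finset.cons (Fin.last n) (Sᶜ.map Fin.castSuccEmb) (by simp) := by
  ext i
  induction i using Fin.lastCases <;> simp [Fin.castSucc_ne_last]

theorem Fin.compl_insert_last_map_castSuccEmb {n : ℕ} (S : Finset (Fin n)) :
    (insert (Fin.last n) (S.map Fin.castSuccEmb))ᶜ = Sᶜ.map Fin.castSuccEmb := by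
  ext i
  induction i using Fin.lastCases <;> simp [Fin.castSucc_ne_last]

theorem LinearMap.hasDerivAt_add_smul_add_smul {W : Type*} [AddCommGroup W] [Module ℝ W]
    (ω : W →ₗ[ℝ] W →ₗ[ℝ] ℝ) (a b c d : W) :
    HasDerivAt (fun t : ℝ => ω (a + t • b) (c + t • d)) (ω a d + ω b c) 0 := by
  have h1 := (hasDerivAt_id' (0 : ℝ)).mul_const (ω a d + ω b c)
  have h2 := (hasDerivAt_pow 2 (0 : ℝ)).mul_const (ω b d)
  have h : (fun t : ℝ => ω (a + t • b) (c + t • d)) =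
      fun t => ω a c + (t * (ω a d + ω b c) + t ^ 2 * ω b d) := by
    ext t
    simp
    ring
  rw [h]
  simpa using (h1.fun_add h2).const_add (ω a c)

/-- the derivative at `t = 0` of
`t ↦ τ_{A₁+tA₂(v,·), …, A_{s-1}+tA_s(v,·)}(v₀,…,v_{s-1})` equals
`τ_{A₁,…,A_s}(v₀,…,v_{s-2},v,v_{s-1})`.  Here the arguments `v₀,…,v_{s-1}` are
encoded as `w : Fin s → V`, and `A_j(v,·)` is obtained by inserting `v` as the
first argument of `A_j` (via `MultilinearMap.curryLeft`). -/
theorem stmt9 {V W : Type*} [AddCommGroup V] [Module ℝ V]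
    [AddCommGroup W] [Module ℝ W] [FiniteDimensional ℝ V] [FiniteDimensional ℝ W]
    (ω : W →ₗ[ℝ] W →ₗ[ℝ] ℝ)
    (hanti : ∀ w₁ w₂ : W, ω w₁ w₂ = - ω w₂ w₁)
    (hnond : ∀ w : W, (∀ w' : W, ω w w' = 0) → w = 0)
    (s : ℕ) (hs : 3 ≤ s)
    (A : (k : ℕ) → MultilinearMap ℝ (fun _ : Fin k => V) W)
    (hAsym : ∀ k : ℕ, 1 ≤ k → k ≤ s → ∀ (σ : Equiv.Perm (Fin k)) (m : Fin k → V),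
      A k (fun i => m (σ i)) = A k m)
    (v : V) (w : Fin s → V) :
    HasDerivAt
      (fun t : ℝ =>
        tauForm ω (s - 1) (fun k => A k + t • (A (k + 1)).curryLeft v)
          (fun i : Fin (s - 1 + 1) => w ⟨(i : ℕ), lt_of_lt_of_le i.isLt (by omega)⟩))
      (tauForm ω s A (fun i : Fin (s + 1) =>
        if h : (i : ℕ) < s - 1 then w ⟨(i : ℕ), by omega⟩
        else if (i : ℕ) = s - 1 then v
        else w ⟨s - 1, by omega⟩))
      0 := by
  obtain ⟨n, rfl⟩ : ∃ n, s = n + 2 := ⟨s - 2, by omega⟩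
  set u : Fin (n + 2 + 1) → V := fun i =>
    if h : (i : ℕ) < n + 2 - 1 then w ⟨(i : ℕ), by omega⟩
    else if (i : ℕ) = n + 2 - 1 then v
    else w ⟨n + 2 - 1, by omega⟩ with hu
  have hu_zero : u 0 = w 0 := by simp [hu]
  have hu_mid (i : Fin n) :
      u (midIdx (s := n + 2) i.castSucc) = w (midIdx (s := n + 1) i) := by
    simp [hu, midIdx]
  have hu_mid_last : u (midIdx (s := n + 2) (Fin.last n)) = v := by simp [hu, midIdx]
  have hu_last : u (Fin.last (n + 2)) = w (Fin.last (n + 1)) := by simp [hu, Fin.last]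
  unfold tauForm
  simp only [Nat.add_one_sub_one, _root_.add_apply, _root_.smul_apply]
  rw [Fin.sum_finset_succ, ← Finset.sum_add_distrib]
  refine HasDerivAt.fun_sum fun S _ => ?_
  have hcard : S.card ≤ n := by simpa using S.card_le_univ
  have hcompl : Sᶜ.card = n - S.card := by simp [Finset.card_compl]
  refine (LinearMap.hasDerivAt_add_smul_add_smul ω _ _ _ _).congr_deriv ?_
  refine congrArg₂ (· + ·) ?_ ?_
  · rw [MultilinearMap.curryLeft_apply]
    congr 1
    · congr 1
      refine MultilinearMap.eq_of_map_univ_eq (hAsym _ (by omega) (by simp; omega)) (by simp) ?_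
      rw [Fin.map_univ_val_cons, Fin.map_univ_val_cons,
        Finset.map_univ_val_orderIsoOfFin _ (fun i => u (midIdx i)),
        Finset.map_univ_val_orderIsoOfFin _ (fun i => w (midIdx (s := n + 1) i))]
      simp [hu_zero, hu_mid]
    · refine MultilinearMap.eq_of_map_univ_eq
        (hAsym _ (by simp) (by omega)) (by simp; omega) ?_
      rw [Fin.map_univ_val_cons,
        Finset.map_univ_val_orderIsoOfFin_dite _ (fun i => u (midIdx i)) _
          (by rw [Fin.compl_map_castSuccEmb]; simp; omega),
        Finset.map_univ_val_orderIsoOfFin_dite _ (fun i => w (midIdx (s := n + 1) i)) _ (by omega),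
        Fin.compl_map_castSuccEmb]
      simp [hu_last, hu_mid, hu_mid_last]
      exact Multiset.cons_swap _ _ _
  · rw [MultilinearMap.curryLeft_apply]
    congr 1
    · congr 1
      refine MultilinearMap.eq_of_map_univ_eq (hAsym _ (by omega) (by simp; omega)) (by simp) ?_
      rw [Fin.map_univ_val_cons, Fin.map_univ_val_cons, Fin.map_univ_val_cons,
        Finset.map_univ_val_orderIsoOfFin _ (fun i => u (midIdx i)),
        Finset.map_univ_val_orderIsoOfFin _ (fun i => w (midIdx (s := n + 1) i))]
      simp [hu_zero, hu_mid, hu_mid_last]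
      exact Multiset.cons_swap _ _ _
    · refine MultilinearMap.eq_of_map_univ_eq
        (hAsym _ (by omega) (by omega)) (by simp) ?_
      rw [Finset.map_univ_val_orderIsoOfFin_dite _ (fun i => u (midIdx i)) _
          (by rw [Fin.compl_insert_last_map_castSuccEmb]; simp; omega),
        Finset.map_univ_val_orderIsoOfFin_dite _ (fun i => w (midIdx (s := n + 1) i)) _ (by omega),
        Fin.compl_insert_last_map_castSuccEmb]
      simp [hu_last, hu_mid]
      rfl
end

section
/- Let V be a finite-dimensional real vector space and s ≥ 2 an integer, and let Mult^{s+1}(V) denote the space of all (s+1)-linear real-valued forms on V. Then there exists a linear map Π : Mult^{s+1}(V) → Mult^{s+1}(V) such that: the range of Π equals T_s(V); Πη = η for every η ∈ T_s(V) (so Π is a surjective projection onto T_s(V)); and for every linear subspace S ≤ V and every η ∈ Mult^{s+1}(V) such that η(v₀,…,v_s) = 0 whenever v₀,…,v_s ∈ S, one also has (Πη)(v₀,…,v_s) = 0 whenever v₀,…,v_s ∈ S. -/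
/-- Membership in the space `T_s(V)` of `(s+1)`-linear real-valued forms on `V`
satisfying:
(i) antisymmetry under exchange of the first and last arguments;
(ii) symmetry in the middle `s-1` arguments;
(iii) vanishing of the cyclic sum over the permutations of the arguments in
positions `0`, `1`, `s`. -/
def IsTs {V : Type*} [AddCommGroup V] [Module ℝ V] (s : ℕ)
    (τ : MultilinearMap ℝ (fun _ : Fin (s + 1) => V) ℝ) : Prop :=
  (∀ v : Fin (s + 1) → V,
    τ (fun i => v (Equiv.swap 0 (Fin.last s) i)) = - τ v) ∧
  (∀ (v : Fin (s + 1) → V) (σ : Equiv.Perm (Fin (s + 1))),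
    σ 0 = 0 → σ (Fin.last s) = Fin.last s → τ (fun i => v (σ i)) = τ v) ∧
  (∀ v : Fin (s + 1) → V,
    τ v
      + τ (fun i =>
          v ((Equiv.swap (1 : Fin (s + 1)) (Fin.last s) * Equiv.swap 0 1 :
            Equiv.Perm (Fin (s + 1))) i))
      + τ (fun i =>
          v ((Equiv.swap (1 : Fin (s + 1)) (Fin.last s) * Equiv.swap 0 1 :
              Equiv.Perm (Fin (s + 1)))
            ((Equiv.swap (1 : Fin (s + 1)) (Fin.last s) * Equiv.swap 0 1 :
              Equiv.Perm (Fin (s + 1))) i))) = 0)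

/-- In a semisimple ring, every left ideal is generated by an idempotent; here `f` is the
complement of such an idempotent. -/
theorem exists_mul_eq_zero_and_one_sub_mem_span {A : Type*} [Ring A] [IsSemisimpleRing A]
    (K : Set A) : ∃ f : A, (∀ k ∈ K, k * f = 0) ∧ 1 - f ∈ Ideal.span K := by
  obtain ⟨J', hJ'⟩ := exists_isCompl (Ideal.span K)
  have h1 : (1 : A) ∈ Ideal.span K ⊔ J' := by rw [hJ'.sup_eq_top]; trivial
  obtain ⟨e, he, f, hf, hef⟩ := Submodule.mem_sup.1 h1
  have hfe : 1 - f = e := by rw [← hef]; abel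
  refine ⟨f, fun k hk => ?_, hfe ▸ he⟩
  have hkf : k * f ∈ Ideal.span K := by
    have : k * f = k - k * e := by rw [← hfe, mul_sub, mul_one, sub_sub_cancel]
    rw [this]
    exact sub_mem (Ideal.subset_span hk) (Ideal.mul_mem_left _ _ he)
  exact Submodule.disjoint_def.1 hJ'.disjoint _ hkf (J'.smul_mem k hf)

/-- The representation of the permutations of `ι` on multilinear forms by permuting arguments. -/
def MultilinearMap.permRep (ι V : Type*) [AddCommGroup V] [Module ℝ V] :
    Representation ℝ (Equiv.Perm ι) (MultilinearMap ℝ (fun _ : ι => V) ℝ) where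
  toFun σ :=
    { toFun := fun η => η.domDomCongr σ
      map_add' := fun _ _ => rfl
      map_smul' := fun _ _ => rfl }
  map_one' := rfl
  map_mul' _ _ := rfl

theorem MultilinearMap.permRep_apply {ι V : Type*} [AddCommGroup V] [Module ℝ V]
    (σ : Equiv.Perm ι) (η : MultilinearMap ℝ (fun _ : ι => V) ℝ) (v : ι → V) :
    permRep ι V σ η v = η (fun i => v (σ i)) := rfl

/-- The elements of the group algebra whose common kernel is `T_s(V)`. -/
def tsRelations (s : ℕ) : Set (MonoidAlgebra ℝ (Equiv.Perm (Fin (s + 1)))) :=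
  {MonoidAlgebra.of ℝ _ (Equiv.swap 0 (Fin.last s)) + 1} ∪
  {a | ∃ σ : Equiv.Perm (Fin (s + 1)), σ 0 = 0 ∧ σ (Fin.last s) = Fin.last s ∧
    a = MonoidAlgebra.of ℝ _ σ - 1} ∪
  {1 + MonoidAlgebra.of ℝ _ (Equiv.swap 1 (Fin.last s) * Equiv.swap 0 1) +
    MonoidAlgebra.of ℝ _ ((Equiv.swap 1 (Fin.last s) * Equiv.swap 0 1) *
      (Equiv.swap 1 (Fin.last s) * Equiv.swap 0 1))}

theorem isTs_iff_forall_tsRelations {V : Type*} [AddCommGroup V] [Module ℝ V] (s : ℕ)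
    (τ : MultilinearMap ℝ (fun _ : Fin (s + 1) => V) ℝ) :
    IsTs s τ ↔ ∀ k ∈ tsRelations s,
      (MultilinearMap.permRep (Fin (s + 1)) V).asAlgebraHom k τ = 0 := by
  constructor
  · rintro ⟨h1, h2, h3⟩ k ((rfl | ⟨σ, h0, hl, rfl⟩) | rfl) <;> ext v
    · simpa [Representation.asAlgebraHom_of, MultilinearMap.permRep_apply,
        add_eq_zero_iff_eq_neg] using h1 v
    · simpa [Representation.asAlgebraHom_of, MultilinearMap.permRep_apply, sub_eq_zero]
        using h2 v σ h0 hl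
    · simp only [map_add, map_one, Representation.asAlgebraHom_of]
      exact h3 v
  · intro h
    refine ⟨fun v => ?_, fun v σ h0 hl => ?_, fun v => ?_⟩
    · have := congrArg (fun η => η v) (h _ (Or.inl (Or.inl rfl)))
      simpa [Representation.asAlgebraHom_of, MultilinearMap.permRep_apply,
        add_eq_zero_iff_eq_neg] using this
    · have := congrArg (fun η => η v) (h _ (Or.inl (Or.inr ⟨σ, h0, hl, rfl⟩)))
      simpa [Representation.asAlgebraHom_of, MultilinearMap.permRep_apply, sub_eq_zero]
        using this
    · have := congrArg (fun η => η v) (h _ (Or.inr rfl))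
      simp only [map_add, map_one, Representation.asAlgebraHom_of] at this
      exact this

theorem MultilinearMap.permRep_asAlgebraHom_apply_eq_zero {ι V : Type*} [AddCommGroup V]
    [Module ℝ V] (a : MonoidAlgebra ℝ (Equiv.Perm ι)) (η : MultilinearMap ℝ (fun _ : ι => V) ℝ)
    (S : Set V) (h : ∀ v : ι → V, (∀ i, v i ∈ S) → η v = 0) (v : ι → V) (hv : ∀ i, v i ∈ S) :
    (permRep ι V).asAlgebraHom a η v = 0 := by
  induction a using MonoidAlgebra.induction_on with
  | of σ =>
    rw [Representation.asAlgebraHom_of, permRep_apply]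
    exact h _ fun i => hv (σ i)
  | add a b ha hb => simp [ha, hb]
  | smul r a ha => simp [ha]

/-- there is a linear projection `P` of the space of `(s+1)`-linear
real-valued forms on `V` onto `T_s(V)` which moreover preserves the property of
vanishing on all tuples drawn from any given linear subspace `S' ≤ V`. -/
theorem stmt10 {V : Type*} [AddCommGroup V] [Module ℝ V] [FiniteDimensional ℝ V]
    (s : ℕ) (hs : 2 ≤ s) :
    ∃ P : MultilinearMap ℝ (fun _ : Fin (s + 1) => V) ℝ →ₗ[ℝ]
        MultilinearMap ℝ (fun _ : Fin (s + 1) => V) ℝ,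
      (∀ η, IsTs s (P η)) ∧
      (∀ τ, IsTs s τ → P τ = τ) ∧
      (∀ (S' : Submodule ℝ V) (η : MultilinearMap ℝ (fun _ : Fin (s + 1) => V) ℝ),
        (∀ v : Fin (s + 1) → V, (∀ i, v i ∈ S') → η v = 0) →
        ∀ v : Fin (s + 1) → V, (∀ i, v i ∈ S') → P η v = 0) := by
  obtain ⟨f, hf, hf'⟩ := exists_mul_eq_zero_and_one_sub_mem_span (tsRelations s)
  refine ⟨(MultilinearMap.permRep (Fin (s + 1)) V).asAlgebraHom f, fun η => ?_, fun τ hτ => ?_,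
    fun S' η h => MultilinearMap.permRep_asAlgebraHom_apply_eq_zero f η S' h⟩
  · rw [isTs_iff_forall_tsRelations]
    intro k hk
    rw [← Module.End.mul_apply, ← map_mul, hf k hk, map_zero, LinearMap.zero_apply]
  · rw [isTs_iff_forall_tsRelations] at hτ
    have key : ∀ a ∈ Ideal.span (tsRelations s),
        (MultilinearMap.permRep (Fin (s + 1)) V).asAlgebraHom a τ = 0 := by
      intro a ha
      induction ha using Submodule.span_induction with
      | mem k hk => exact hτ k hk
      | zero => simp
      | add a b _ _ ha hb => simp [ha, hb]
      | smul r a _ ha => rw [smul_eq_mul, map_mul, Module.End.mul_apply, ha, map_zero]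
    have := key _ hf'
    rw [map_sub, map_one, LinearMap.sub_apply, Module.End.one_apply, sub_eq_zero] at this
    exact this.symm
end

section
/- Let V and W be finite-dimensional real vector spaces, let ω be a nondegenerate antisymmetric bilinear form on W, and let A : V → W be an injective linear map. Then for every antisymmetric bilinear form C on V (C(v₁,v₂) = −C(v₂,v₁)) there exists a linear map B : V → W such that C(v₁,v₂) = ω(A v₁, B v₂) + ω(B v₁, A v₂) for all v₁, v₂ ∈ V. -/
/-- if `ω` is a nondegenerate antisymmetric bilinear form on `W` and
`A : V → W` is an injective linear map, then every antisymmetric bilinear form `C`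
on `V` can be written as `C(v₁,v₂) = ω(Av₁, Bv₂) + ω(Bv₁, Av₂)` for some linear
`B : V → W`. -/
theorem stmt12 {V W : Type*} [AddCommGroup V] [Module ℝ V]
    [AddCommGroup W] [Module ℝ W] [FiniteDimensional ℝ V] [FiniteDimensional ℝ W]
    (ω : W →ₗ[ℝ] W →ₗ[ℝ] ℝ)
    (hanti : ∀ w₁ w₂ : W, ω w₁ w₂ = - ω w₂ w₁)
    (hnond : ∀ w : W, (∀ w' : W, ω w w' = 0) → w = 0)
    (A : V →ₗ[ℝ] W) (hA : Function.Injective A)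
    (C : V →ₗ[ℝ] V →ₗ[ℝ] ℝ) (hC : ∀ v₁ v₂ : V, C v₁ v₂ = - C v₂ v₁) :
    ∃ B : V →ₗ[ℝ] W, ∀ v₁ v₂ : V, C v₁ v₂ = ω (A v₁) (B v₂) + ω (B v₁) (A v₂) := by
  obtain ⟨P, hP⟩ := A.exists_leftInverse_of_injective (LinearMap.ker_eq_bot.mpr hA)
  have hPA (v : V) : P (A v) = v := LinearMap.congr_fun hP v
  have hω : Function.Injective ω := (injective_iff_map_eq_zero ω).mpr fun w hw =>
    hnond w fun w' => by rw [hw, LinearMap.zero_apply]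
  let e := ω.linearEquivOfInjective hω Subspace.dual_finrank_eq.symm
  let B : V →ₗ[ℝ] W := e.symm.toLinearMap ∘ₗ ((1 / 2 : ℝ) • C.compl₂ P)
  have hB (v₁ v₂ : V) : ω (B v₁) (A v₂) = 1 / 2 * C v₁ v₂ := by
    have h : ω (B v₁) = ((1 / 2 : ℝ) • C.compl₂ P) v₁ := e.apply_symm_apply _
    simp [h, hPA]
  refine ⟨B, fun v₁ v₂ => ?_⟩
  rw [hanti (A v₁), hB, hB, hC v₂ v₁]
  ring
end

section
/- Let V be a finite-dimensional real vector space with dim V ≥ 2 and let s ≥ 2 be an integer. Then the space T_s(V) has dimension at least s. (In particular, if v₀, v₁ ∈ V are linearly independent, the s evaluation functionals sending τ ∈ T_s(V) to τ(v₀,…,v₀,v₁,…,v₁), with v₀ repeated i times and v₁ repeated s+1−i times for 1 ≤ i ≤ s, are linearly independent.) -/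
/-- The form `v ↦ α(v₀) β(vₛ) γ(v₁) ⋯ γ(vₛ₋₁)`. -/
noncomputable def hookMonomial {V : Type*} [AddCommGroup V] [Module ℝ V] (s : ℕ)
    (α β γ : V →ₗ[ℝ] ℝ) : MultilinearMap ℝ (fun _ : Fin (s + 1) => V) ℝ :=
  (MultilinearMap.mkPiAlgebra ℝ (Fin (s + 1)) ℝ).compLinearMap
    (fun i => if i = 0 then α else if i = Fin.last s then β else γ)

theorem hookMonomial_apply {V : Type*} [AddCommGroup V] [Module ℝ V] {s : ℕ} (hs : s ≠ 0)
    (α β γ : V →ₗ[ℝ] ℝ) (v : Fin (s + 1) → V) :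
    hookMonomial s α β γ v = α (v 0) * β (v (Fin.last s)) *
      ∏ i ∈ (Finset.univ.erase 0).erase (Fin.last s), γ (v i) := by
  have hlast : Fin.last s ≠ 0 := by
    simpa [Fin.ext_iff] using hs
  rw [hookMonomial, MultilinearMap.compLinearMap_apply, MultilinearMap.mkPiAlgebra_apply,
    ← Finset.mul_prod_erase _ _ (Finset.mem_univ (0 : Fin (s + 1))),
    ← Finset.mul_prod_erase _ _ (Finset.mem_erase.2 ⟨hlast, Finset.mem_univ _⟩)]
  simp only [if_true, if_neg hlast, mul_assoc]
  congr 2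
  refine Finset.prod_congr rfl fun i hi => ?_
  simp only [Finset.mem_erase] at hi
  rw [if_neg hi.2.1, if_neg hi.1]

/-- The form `v ↦ (α ∧ β)(v₀, vₛ) γ(v₁) ⋯ γ(vₛ₋₁)`. -/
noncomputable def wedgeForm {V : Type*} [AddCommGroup V] [Module ℝ V] (s : ℕ)
    (α β γ : V →ₗ[ℝ] ℝ) : MultilinearMap ℝ (fun _ : Fin (s + 1) => V) ℝ :=
  hookMonomial s α β γ - hookMonomial s β α γ

theorem wedgeForm_apply {V : Type*} [AddCommGroup V] [Module ℝ V] {s : ℕ} (hs : s ≠ 0)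
    (α β γ : V →ₗ[ℝ] ℝ) (v : Fin (s + 1) → V) :
    wedgeForm s α β γ v =
      (α (v 0) * β (v (Fin.last s)) - β (v 0) * α (v (Fin.last s))) *
        ∏ i ∈ (Finset.univ.erase 0).erase (Fin.last s), γ (v i) := by
  rw [wedgeForm, sub_apply, hookMonomial_apply hs, hookMonomial_apply hs, sub_mul]

theorem isTs_wedgeForm {V : Type*} [AddCommGroup V] [Module ℝ V] {s : ℕ} (hs : 2 ≤ s)
    (α β : V →ₗ[ℝ] ℝ) (t : ℝ) : IsTs s (wedgeForm s α β (α + t • β)) := by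
  have hs0 : s ≠ 0 := by omega
  have one_val : ((1 : Fin (s + 1)) : ℕ) = 1 := by
    rw [Fin.val_one']; exact Nat.mod_eq_of_lt (by omega)
  have h0l : (0 : Fin (s + 1)) ≠ Fin.last s := by
    simpa [Fin.ext_iff] using hs0.symm
  have h10 : (1 : Fin (s + 1)) ≠ 0 := by
    rw [Ne, Fin.ext_iff, one_val]; simp
  have h1l : (1 : Fin (s + 1)) ≠ Fin.last s := by
    rw [Ne, Fin.ext_iff, one_val, Fin.val_last]; omega
  refine ⟨fun v => ?_, fun v σ hσ0 hσl => ?_, fun v => ?_⟩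
  · have hmid : ∏ i ∈ (Finset.univ.erase 0).erase (Fin.last s),
          (α + t • β) (v (Equiv.swap 0 (Fin.last s) i)) =
        ∏ i ∈ (Finset.univ.erase 0).erase (Fin.last s), (α + t • β) (v i) := by
      refine Finset.prod_congr rfl fun i hi => ?_
      simp only [Finset.mem_erase] at hi
      rw [Equiv.swap_apply_of_ne_of_ne hi.2.1 hi.1]
    simp only [wedgeForm_apply hs0, hmid, Equiv.swap_apply_left, Equiv.swap_apply_right]
    ring
  · have hmid : ∏ i ∈ (Finset.univ.erase 0).erase (Fin.last s), (α + t • β) (v (σ i)) =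
        ∏ i ∈ (Finset.univ.erase 0).erase (Fin.last s), (α + t • β) (v i) := by
      refine Finset.prod_equiv σ (fun i => ?_) fun _ _ => rfl
      have h0 : σ i = 0 ↔ i = 0 := by
        simpa only [hσ0] using σ.injective.eq_iff (a := i) (b := 0)
      have hl : σ i = Fin.last s ↔ i = Fin.last s := by
        simpa only [hσl] using σ.injective.eq_iff (a := i) (b := Fin.last s)
      simp [h0, hl]
    simp only [wedgeForm_apply hs0, hmid, hσ0, hσl]
  · set c : Equiv.Perm (Fin (s + 1)) := Equiv.swap 1 (Fin.last s) * Equiv.swap 0 1 with hc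
    have hc0 : c 0 = Fin.last s := by simp [hc]
    have hc1 : c 1 = 0 := by
      simp [hc, Equiv.swap_apply_of_ne_of_ne h10.symm h0l]
    have hcl : c (Fin.last s) = 1 := by
      simp [hc, Equiv.swap_apply_of_ne_of_ne h0l.symm h1l.symm]
    have hcfix : ∀ i, i ≠ 0 → i ≠ 1 → i ≠ Fin.last s → c i = i := fun i h0 h1 hl => by
      simp [hc, Equiv.swap_apply_of_ne_of_ne h0 h1, Equiv.swap_apply_of_ne_of_ne h1 hl]
    have hmem : (1 : Fin (s + 1)) ∈ (Finset.univ.erase 0).erase (Fin.last s) := by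
      simp [h10, h1l]
    have hrest : ∏ i ∈ ((Finset.univ.erase 0).erase (Fin.last s)).erase 1,
          (α + t • β) (v (c i)) =
        ∏ i ∈ ((Finset.univ.erase 0).erase (Fin.last s)).erase 1, (α + t • β) (v i) := by
      refine Finset.prod_congr rfl fun i hi => ?_
      simp only [Finset.mem_erase] at hi
      rw [hcfix i hi.2.2.1 hi.1 hi.2.1]
    have hrest₂ : ∏ i ∈ ((Finset.univ.erase 0).erase (Fin.last s)).erase 1,
          (α + t • β) (v (c (c i))) =
        ∏ i ∈ ((Finset.univ.erase 0).erase (Fin.last s)).erase 1, (α + t • β) (v i) := by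
      refine Finset.prod_congr rfl fun i hi => ?_
      simp only [Finset.mem_erase] at hi
      have := hcfix i hi.2.2.1 hi.1 hi.2.1
      rw [this, this]
    simp only [wedgeForm_apply hs0, ← Finset.mul_prod_erase _ _ hmem, hrest, hrest₂,
      hc0, hc1, hcl]
    simp only [LinearMap.add_apply, LinearMap.smul_apply, smul_eq_mul]
    ring

/-- If `α, β` are dual to `x, y`, the forms `(α ∧ β)(v₀, vₛ) ∏ (α + tβ)(vᵢ)` for `s` distinct
values of `t` are linearly independent. -/
theorem linearIndependent_wedgeForm {V : Type*} [AddCommGroup V] [Module ℝ V] {s : ℕ}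
    (hs : s ≠ 0) {α β : V →ₗ[ℝ] ℝ} {x y : V} (hαx : α x = 1) (hαy : α y = 0) (hβx : β x = 0)
    (hβy : β y = 1) {t : Fin s → ℝ} (ht : Function.Injective t) :
    LinearIndependent ℝ fun k => wedgeForm s α β (α + t k • β) := by
  have hl : Fin.last s ≠ 0 := by simpa [Fin.ext_iff] using hs
  rw [Fintype.linearIndependent_iff]
  intro c hc
  refine congrFun (Matrix.eq_zero_of_forall_pow_sum_mul_pow_eq_zero ht fun j => ?_)
  let v : Fin (s + 1) → V := fun i =>
    if i = 0 then x else if (i : ℕ) ≤ j ∨ i = Fin.last s then y else x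
  have key : ∀ k, wedgeForm s α β (α + t k • β) v = t k ^ (j : ℕ) := fun k => by
    have hv0 : v 0 = x := by simp [v]
    have hvl : v (Fin.last s) = y := by simp [v, hl]
    have hmid : ∀ i ∈ (Finset.univ.erase 0).erase (Fin.last s),
        (α + t k • β) (v i) = if (i : ℕ) ≤ j then t k else 1 := fun i hi => by
      simp only [Finset.mem_erase] at hi
      by_cases h : (i : ℕ) ≤ j <;> simp [v, hi, h, hαx, hαy, hβx, hβy]
    have hcard : (((Finset.univ.erase 0).erase (Fin.last s)).filter
        fun i : Fin (s + 1) => (i : ℕ) ≤ j).card = j := by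
      have : ((Finset.univ.erase 0).erase (Fin.last s)).filter
          (fun i : Fin (s + 1) => (i : ℕ) ≤ j) = Finset.Ioc 0 j.castSucc := by
        ext i
        simp only [Finset.mem_filter, Finset.mem_erase, Finset.mem_univ, Finset.mem_Ioc, ne_eq,
          Fin.ext_iff, Fin.lt_def, Fin.le_def, Fin.val_last, Fin.val_zero, Fin.val_castSucc,
          and_true]
        have := j.isLt
        omega
      simp [this]
    rw [wedgeForm_apply hs, Finset.prod_congr rfl hmid, hv0, hvl, hαx, hβy, hβx, hαy,
      Finset.prod_ite, Finset.prod_const, Finset.prod_const_one, hcard]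
    ring
  have := congrArg (fun τ => τ v) hc
  simpa [sum_apply, key] using this

/-- if `dim V ≥ 2` and `s ≥ 2`, then the space `T_s(V)` (realized as
any submodule `T` of the `(s+1)`-linear forms whose membership is given by the
defining conditions) has dimension at least `s`. -/
theorem stmt14 {V : Type*} [AddCommGroup V] [Module ℝ V] [FiniteDimensional ℝ V]
    (hV : 2 ≤ Module.finrank ℝ V) (s : ℕ) (hs : 2 ≤ s)
    (T : Submodule ℝ (MultilinearMap ℝ (fun _ : Fin (s + 1) => V) ℝ))
    (hT : ∀ τ, τ ∈ T ↔ IsTs s τ) :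
    s ≤ Module.finrank ℝ ↥T := by
  have hs0 : s ≠ 0 := by omega
  let b := Module.finBasis ℝ V
  let i : Fin (Module.finrank ℝ V) := ⟨0, by omega⟩
  let j : Fin (Module.finrank ℝ V) := ⟨1, by omega⟩
  have hij : i ≠ j := by simp [i, j]
  have hli := linearIndependent_wedgeForm hs0 (α := b.coord i) (β := b.coord j)
    (x := b i) (y := b j) (by simp) (by simp [hij.symm]) (by simp [hij]) (by simp)
    (t := fun k : Fin s => (k : ℝ)) (fun k l h => Fin.ext (Nat.cast_injective h))
  have hli' : LinearIndependent ℝ fun k : Fin s =>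
      (⟨_, (hT _).2 (isTs_wedgeForm hs (b.coord i) (b.coord j) k)⟩ : T) :=
    LinearIndependent.of_comp T.subtype hli
  simpa using hli'.fintype_card_le_finrank
end
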